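/- arXiv:1508.00064 — 3 statements merged into one kernel-verified Lean document; each statement's English description precedes it below -/
import Mathlib

section
/- Let R > 0 and let p₁, …, p_n ∈ ℂ and r₁, …, r_n > 0 be such that the closed disks D̄(p_i, r_i) are pairwise disjoint and contained in the open disk D(0,R). Set Ω = D(0,R) ∖ ⋃_{i=1}^n D̄(p_i, r_i). Let g be a complex-valued continuously differentiable function on an open neighborhood of the closure of Ω. Define g⁺(z) = (1/(2πI)) ∮_{C(0,R)} g(w)/(w − z) dw for z ∈ D(0,R), and g_i⁻(z) = −(1/(2πI)) ∮_{C(p_i,r_i)} g(w)/(w − z) dw for z ∉ D̄(p_i,r_i). Then: (1) g⁺ is holomorphic on D(0,R); (2) each g_i⁻ is holomorphic on ℂ ∖ D̄(p_i,r_i) and tends to 0 as |z| → ∞; (3) for every z ∈ Ω, g(z) = g⁺(z) + Σ_{i=1}^n g_i⁻(z) − (1/π) ∫_Ω ((∂g/∂w̄)(w)/(w − z)) dA(w), where dA is the Lebesgue (area) measure on ℂ. -/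
noncomputable section

open Complex MeasureTheory

/-- The Wirtinger derivative `∂g/∂z̄ = (1/2)(∂g/∂x + I·∂g/∂y)` of a complex-valued
function `g` on `ℂ`. -/
def dbar (g : ℂ → ℂ) (w : ℂ) : ℂ :=
  (1 / 2 : ℂ) * (fderiv ℝ g w 1 + Complex.I * fderiv ℝ g w Complex.I)

/-- The Cauchy transform of `g` over the circle `C(0,R)`. -/
def cauchyPlus (R : ℝ) (g : ℂ → ℂ) (z : ℂ) : ℂ :=
  (1 / (2 * Real.pi * Complex.I)) * ∮ w in C(0, R), g w / (w - z)

/-- Minus the Cauchy transform of `g` over the circle `C(p,r)`. -/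
def cauchyMinus (p : ℂ) (r : ℝ) (g : ℂ → ℂ) (z : ℂ) : ℂ :=
  -((1 / (2 * Real.pi * Complex.I)) * ∮ w in C(p, r), g w / (w - z))

/-- A real-linear map on `ℂ` is determined by its values at `1` and `I`. -/
lemma clm_apply_eq (L : ℂ →L[ℝ] ℂ) (v : ℂ) : L v = v.re * L 1 + v.im * L Complex.I := by
  have h : v = v.re • (1 : ℂ) + v.im • Complex.I := by
    apply Complex.ext <;> simp
  conv_lhs => rw [h]
  rw [map_add, map_smul, map_smul, Complex.real_smul, Complex.real_smul]

lemma continuous_dbar {F : ℂ → ℂ} (hF : ContDiff ℝ 1 F) : Continuous (dbar F) := by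
  have h := hF.continuous_fderiv (by norm_num)
  unfold dbar
  fun_prop

lemma polar_div_aux {F : ℂ → ℂ} (hF : ContDiff ℝ 1 F) (c : ℂ) (p : ℝ × ℝ) :
    ∃ f' g' : ℝ × ℝ →L[ℝ] ℂ,
      HasFDerivAt (fun p : ℝ × ℝ => (p.1 : ℂ) * cexp (p.2 * I) * I * F (c + p.1 * cexp (p.2 * I))) f' p ∧
      HasFDerivAt (fun p : ℝ × ℝ => -(cexp (p.2 * I) * F (c + p.1 * cexp (p.2 * I)))) g' p ∧
      f' (1, 0) + g' (0, 1) = 2 * I * (p.1 * dbar F (c + p.1 * cexp (p.2 * I))) := by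
  have h1 : HasFDerivAt (fun p : ℝ × ℝ => (p.1 : ℂ)) (Complex.ofRealCLM ∘L ContinuousLinearMap.fst ℝ ℝ ℝ) p :=
    (Complex.ofRealCLM ∘L ContinuousLinearMap.fst ℝ ℝ ℝ).hasFDerivAt
  have h2 : HasFDerivAt (fun p : ℝ × ℝ => (p.2 : ℂ)) (Complex.ofRealCLM ∘L ContinuousLinearMap.snd ℝ ℝ ℝ) p :=
    (Complex.ofRealCLM ∘L ContinuousLinearMap.snd ℝ ℝ ℝ).hasFDerivAt
  have hE := (h2.mul_const I).cexp
  have hP := (h1.mul hE).const_add c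
  have hFP := ((hF.differentiable (by norm_num) (c + p.1 * cexp (p.2 * I))).hasFDerivAt).comp p hP
  refine ⟨_, _, ((h1.mul hE).mul_const I).mul hFP, (hE.mul hFP).neg, ?_⟩
  simp only [dbar]
  set L := fderiv ℝ F (c + p.1 * cexp (p.2 * I)) with hL
  simp
  have e1 := clm_apply_eq L (cexp (p.2 * I))
  have e2 := clm_apply_eq L (p.1 * (cexp (p.2 * I) * I))
  rw [e1, e2]
  have hre : (cexp (p.2 * I)).re = Real.cos p.2 := by simp [Complex.exp_ofReal_mul_I_re]
  have him : (cexp (p.2 * I)).im = Real.sin p.2 := by simp [Complex.exp_ofReal_mul_I_im]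
  simp only [Complex.mul_re, Complex.mul_im, Complex.ofReal_re, Complex.ofReal_im, Complex.I_re,
    Complex.I_im, hre, him]
  push_cast
  have hexp : cexp (p.2 * I) = Complex.cos p.2 + Complex.sin p.2 * I := Complex.exp_mul_I _
  rw [hexp]
  have hcs := Complex.sin_sq_add_cos_sq (p.2 : ℂ)
  have hI := Complex.I_sq
  generalize Complex.cos p.2 = C at *
  generalize Complex.sin p.2 = S at *
  generalize (F _) = Y
  linear_combination (p.1 : ℂ) * I * (L 1 + I * L I) * hcs + (p.1 * C * S * L 1 - p.1 * C ^ 2 * L I) * hI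

lemma stokes_disc {F : ℂ → ℂ} (hF : ContDiff ℝ 1 F) (c : ℂ) {r : ℝ} (hr : 0 ≤ r) :
    (∮ w in C(c, r), F w) = 2 * I * ∫ w in Metric.ball c r, dbar F w := by
  have hcd := continuous_dbar hF
  have hcF := hF.continuous
  choose f' g' hf' hg' hfg using polar_div_aux hF c
  have hdiv := integral2_divergence_prod_of_hasFDerivAt_off_countable (f' := f') (g' := g')
    (a₁ := 0) (a₂ := -Real.pi) (b₁ := r) (b₂ := Real.pi) (s := ∅) (hs := Set.countable_empty)
    (f := fun p : ℝ × ℝ => (p.1 : ℂ) * cexp (p.2 * I) * I * F (c + p.1 * cexp (p.2 * I)))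
    (g := fun p : ℝ × ℝ => -(cexp (p.2 * I) * F (c + p.1 * cexp (p.2 * I))))
    (Hcf := by fun_prop) (Hcg := by fun_prop) (Hdf := fun x _ => hf' x) (Hdg := fun x _ => hg' x)
    (Hi := by
      simp only [hfg]
      apply ContinuousOn.integrableOn_compact (isCompact_uIcc.prod isCompact_uIcc)
      fun_prop)
  have hexp : cexp (-(Real.pi * I)) = cexp (Real.pi * I) := by
    rw [Complex.exp_neg, Complex.exp_pi_mul_I]; norm_num
  simp only [hfg] at hdiv
  simp [hexp] at hdiv
  -- circle integral
  have hcirc : (∮ w in C(c, r), F w) =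
      ∫ y in (-Real.pi)..Real.pi, (r : ℂ) * cexp (y * I) * I * F (c + r * cexp (y * I)) := by
    have hper : Function.Periodic
        (fun y : ℝ => (r : ℂ) * cexp (y * I) * I * F (c + r * cexp (y * I))) (2 * Real.pi) := by
      intro y
      have : cexp ((y + 2 * Real.pi : ℝ) * I) = cexp (y * I) := by
        push_cast
        rw [add_mul]
        exact Complex.exp_periodic _
      simp only [this]
    have := hper.intervalIntegral_add_eq 0 (-Real.pi)
    rw [show -Real.pi + 2 * Real.pi = Real.pi by ring, zero_add] at this
    rw [← this, circleIntegral]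
    simp [circleMap]
  have hpol : (∫ w in Metric.ball c r, dbar F w) =
      ∫ x in (0:ℝ)..r, ∫ y in (-Real.pi)..Real.pi, (x : ℂ) * dbar F (c + x * cexp (y * I)) := by
    rw [← integral_indicator measurableSet_ball, ← integral_add_left_eq_self _ c,
      ← Complex.integral_comp_polarCoord_symm]
    have hset : ∀ p ∈ polarCoord.target,
        p.1 • (Metric.ball c r).indicator (dbar F) (c + Complex.polarCoord.symm p) =
        (Set.Ioo 0 r ×ˢ Set.Ioo (-Real.pi) Real.pi).indicator
          (fun p : ℝ × ℝ => (p.1 : ℂ) * dbar F (c + p.1 * cexp (p.2 * I))) p := by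
      rintro ⟨x, y⟩ hp
      rw [polarCoord_target] at hp
      have hx : 0 < x := hp.1
      have hy := hp.2
      have hs : Complex.polarCoord.symm (x, y) = x * cexp (y * I) := by
        rw [Complex.polarCoord_symm_apply, Complex.exp_mul_I]; simp
      have hn : c + x * cexp (y * I) ∈ Metric.ball c r ↔ x < r := by
        simp [abs_of_pos hx]
      rw [hs]
      by_cases hxr : x < r
      · rw [Set.indicator_of_mem (hn.2 hxr), Set.indicator_of_mem
          (show (x, y) ∈ Set.Ioo 0 r ×ˢ Set.Ioo (-Real.pi) Real.pi from ⟨⟨hx, hxr⟩, hy⟩)]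
        simp
      · rw [Set.indicator_of_notMem (fun h => hxr (hn.1 h)),
          Set.indicator_of_notMem (fun h => hxr h.1.2)]
        simp
    rw [setIntegral_congr_fun polarCoord.open_target.measurableSet hset,
      setIntegral_indicator (measurableSet_Ioo.prod measurableSet_Ioo)]
    have hinter : polarCoord.target ∩ Set.Ioo 0 r ×ˢ Set.Ioo (-Real.pi) Real.pi =
        Set.Ioo 0 r ×ˢ Set.Ioo (-Real.pi) Real.pi := by
      rw [polarCoord_target]
      apply Set.inter_eq_right.2
      rintro ⟨x, y⟩ ⟨h, h'⟩
      exact ⟨h.1, h'⟩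
    rw [hinter, Measure.volume_eq_prod, setIntegral_prod]
    · rw [intervalIntegral.integral_of_le hr, integral_Ioc_eq_integral_Ioo]
      refine setIntegral_congr_fun measurableSet_Ioo fun x _ => ?_
      simp only
      rw [intervalIntegral.integral_of_le (by linarith [Real.pi_pos]), integral_Ioc_eq_integral_Ioo]
    · rw [← Measure.volume_eq_prod]
      apply IntegrableOn.mono_set (t := Set.Icc 0 r ×ˢ Set.Icc (-Real.pi) Real.pi)
      · apply ContinuousOn.integrableOn_compact (isCompact_Icc.prod isCompact_Icc)
        fun_prop
      · exact Set.prod_mono Set.Ioo_subset_Icc_self Set.Ioo_subset_Icc_self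
  rw [hcirc, hpol, ← hdiv]
  simp

/-- The regularized Cauchy kernel. -/
def regKernel (z : ℂ) (ε : ℝ) (w : ℂ) : ℂ :=
  (starRingEnd ℂ) (w - z) / ((starRingEnd ℂ) (w - z) * (w - z) + ε)

lemma regDen_eq (z : ℂ) (ε : ℝ) (w : ℂ) :
    (starRingEnd ℂ) (w - z) * (w - z) + ε = ((‖w - z‖ ^ 2 + ε : ℝ) : ℂ) := by
  rw [Complex.conj_mul']; push_cast; rfl

lemma regDen_ne (z : ℂ) {ε : ℝ} (hε : 0 < ε) (w : ℂ) :
    (starRingEnd ℂ) (w - z) * (w - z) + ε ≠ 0 := by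
  rw [regDen_eq]
  have : 0 < ‖w - z‖ ^ 2 + ε := by positivity
  exact_mod_cast this.ne'

lemma contDiff_regKernel (z : ℂ) {ε : ℝ} (hε : 0 < ε) : ContDiff ℝ 1 (regKernel z ε) := by
  have hq : ContDiff ℝ 1 (fun w : ℂ => w - z) := by fun_prop
  have hc : ContDiff ℝ 1 (fun w : ℂ => (starRingEnd ℂ) (w - z)) :=
    Complex.conjCLE.contDiff.comp hq
  unfold regKernel
  simp only [div_eq_mul_inv]
  exact hc.mul (((hc.mul hq).add contDiff_const).inv (fun w => regDen_ne z hε w))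

lemma dbar_mul {f g : ℂ → ℂ} {w : ℂ} (hf : DifferentiableAt ℝ f w) (hg : DifferentiableAt ℝ g w) :
    dbar (fun w => f w * g w) w = dbar f w * g w + f w * dbar g w := by
  have h := (hf.hasFDerivAt.mul hg.hasFDerivAt).fderiv
  have h' : fderiv ℝ (fun w => f w * g w) w = _ := h
  simp only [dbar, h']
  simp
  ring

lemma dbar_regKernel (z : ℂ) {ε : ℝ} (hε : 0 < ε) (w : ℂ) :
    dbar (regKernel z ε) w = ε / ((starRingEnd ℂ) (w - z) * (w - z) + ε) ^ 2 := by
  have hne := regDen_ne z hε w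
  have hq : HasFDerivAt (fun w : ℂ => w - z) (ContinuousLinearMap.id ℝ ℂ) w :=
    (hasFDerivAt_id w).sub_const z
  have hc : HasFDerivAt (fun w : ℂ => (starRingEnd ℂ) (w - z))
      ((Complex.conjCLE : ℂ →L[ℝ] ℂ) ∘L (ContinuousLinearMap.id ℝ ℂ)) w :=
    (Complex.conjCLE : ℂ →L[ℝ] ℂ).hasFDerivAt.comp w hq
  have hd := (hc.mul hq).add_const (ε : ℂ)
  have hK : DifferentiableAt ℝ (regKernel z ε) w :=
    (contDiff_regKernel z hε).differentiable (by norm_num) w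
  have hprod := dbar_mul hK hd.differentiableAt
  have e1 : (fun w => regKernel z ε w * ((starRingEnd ℂ) (w - z) * (w - z) + ε)) =
      fun w => (starRingEnd ℂ) (w - z) := by
    funext v
    unfold regKernel
    rw [div_mul_cancel₀ _ (regDen_ne z hε v)]
  have e2 : dbar (fun w : ℂ => (starRingEnd ℂ) (w - z)) w = 1 := by
    simp only [dbar, hc.fderiv]
    simp
    norm_num
  have e3 : dbar (fun w : ℂ => (starRingEnd ℂ) (w - z) * (w - z) + ε) w = w - z := by
    have hd' : fderiv ℝ (fun w : ℂ => (starRingEnd ℂ) (w - z) * (w - z) + ε) w = _ := hd.fderiv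
    simp only [dbar, hd']
    simp
    linear_combination (1/2 : ℂ) * ((starRingEnd ℂ) w - (starRingEnd ℂ) z - w + z) * Complex.I_sq
  have hprod' : dbar (fun w => regKernel z ε w * ((starRingEnd ℂ) (w - z) * (w - z) + ε)) w =
    dbar (regKernel z ε) w * ((starRingEnd ℂ) (w - z) * (w - z) + ε) + regKernel z ε w *
      dbar (fun w : ℂ => (starRingEnd ℂ) (w - z) * (w - z) + ε) w := hprod
  rw [e1, e2, e3] at hprod'
  have hk : regKernel z ε w * ((starRingEnd ℂ) (w - z) * (w - z) + ε) = (starRingEnd ℂ) (w - z) :=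
    congrFun e1 w
  rw [eq_div_iff (pow_ne_zero 2 hne)]
  linear_combination (-((starRingEnd ℂ) (w - z) * (w - z) + ε)) * hprod' - (w - z) * hk

lemma norm_regKernel_le (z : ℂ) {ε : ℝ} (hε : 0 < ε) (w : ℂ) :
    ‖regKernel z ε w‖ ≤ ‖w - z‖⁻¹ := by
  unfold regKernel
  rw [regDen_eq, norm_div, RCLike.norm_conj, Complex.norm_real, Real.norm_eq_abs,
    abs_of_pos (by positivity)]
  rcases (norm_nonneg (w - z)).eq_or_lt with h | h
  · rw [← h]; simp
  · rw [div_le_iff₀ (by positivity), inv_mul_eq_div, le_div_iff₀ h]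
    nlinarith

lemma norm_regErr_le (z : ℂ) {ε : ℝ} (hε : 0 < ε) (w : ℂ) {L : ℝ} {a : ℂ} (hL : 0 ≤ L)
    (ha : ‖a‖ ≤ L * ‖w - z‖) :
    ‖a * (ε / ((starRingEnd ℂ) (w - z) * (w - z) + ε) ^ 2)‖ ≤ L * ‖w - z‖⁻¹ := by
  rw [regDen_eq, norm_mul, norm_div, norm_pow, Complex.norm_real, Complex.norm_real,
    Real.norm_eq_abs, Real.norm_eq_abs, abs_of_pos hε, abs_of_pos (by positivity)]
  rcases (norm_nonneg (w - z)).eq_or_lt with h | h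
  · rw [← h] at ha ⊢
    have : ‖a‖ = 0 := le_antisymm (by simpa using ha) (norm_nonneg _)
    rw [this]; simp
  · set q := ‖w - z‖ with hq
    calc ‖a‖ * (ε / (q ^ 2 + ε) ^ 2) ≤ (L * q) * (1 / q ^ 2) := by
          refine mul_le_mul ha ?_ (by positivity) (by positivity)
          rw [div_le_div_iff₀ (by positivity) (by positivity)]
          nlinarith [sq_nonneg q, mul_pos hε hε, mul_pos hε (pow_pos h 2), pow_pos h 4]
      _ = L * q⁻¹ := by field_simp

lemma tendsto_regKernel {z w : ℂ} (h : w ≠ z) :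
    Filter.Tendsto (fun ε : ℝ => regKernel z ε w) (nhdsWithin 0 (Set.Ioi 0)) (nhds (1 / (w - z))) := by
  have hq : w - z ≠ 0 := sub_ne_zero.2 h
  have hq' : (starRingEnd ℂ) (w - z) ≠ 0 := (map_ne_zero _).2 hq
  have : ContinuousAt (fun ε : ℝ => regKernel z ε w) 0 := by
    unfold regKernel
    apply ContinuousAt.div (by fun_prop) (by fun_prop)
    simp only [ofReal_zero, add_zero]
    exact mul_ne_zero hq' hq
  have h0 : regKernel z 0 w = 1 / (w - z) := by
    unfold regKernel
    simp only [ofReal_zero, add_zero]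
    field_simp
  rw [← h0]
  exact this.tendsto.mono_left nhdsWithin_le_nhds

lemma tendsto_regErr {z w : ℂ} (h : w ≠ z) (a : ℂ) :
    Filter.Tendsto (fun ε : ℝ => a * ((ε : ℂ) / ((starRingEnd ℂ) (w - z) * (w - z) + ε) ^ 2))
      (nhdsWithin 0 (Set.Ioi 0)) (nhds 0) := by
  have hq : w - z ≠ 0 := sub_ne_zero.2 h
  have hq' : (starRingEnd ℂ) (w - z) ≠ 0 := (map_ne_zero _).2 hq
  have : ContinuousAt
      (fun ε : ℝ => a * ((ε : ℂ) / ((starRingEnd ℂ) (w - z) * (w - z) + ε) ^ 2)) 0 := by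
    apply ContinuousAt.mul (by fun_prop)
    apply ContinuousAt.div (by fun_prop) (by fun_prop)
    simp only [ofReal_zero, add_zero]
    exact pow_ne_zero 2 (mul_ne_zero hq' hq)
  have := this.tendsto.mono_left (nhdsWithin_le_nhds (s := Set.Ioi 0))
  simpa using this

lemma integrableOn_inv_norm (c z : ℂ) (r : ℝ) :
    IntegrableOn (fun w : ℂ => ‖w - z‖⁻¹) (Metric.ball c r) := by
  have h0 : IntegrableOn (fun w : ℂ => ‖w‖⁻¹) (Metric.ball 0 (r + ‖c - z‖)) := by
    apply integrableOn_ball_of_norm_le_rpow (C := 1) (α := 1)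
    case hd => simp
    case hα => simp
    case h_decay =>
      refine Filter.Eventually.of_forall fun x => ?_
      rw [Real.rpow_neg_one]; simp
    case h_meas => exact (measurable_norm.inv).aestronglyMeasurable
  rw [← integrable_indicator_iff Metric.isOpen_ball.measurableSet] at h0
  have h1 := h0.comp_sub_right z
  have h2 : IntegrableOn (fun w : ℂ => (Metric.ball (0 : ℂ) (r + ‖c - z‖)).indicator
    (fun w : ℂ => ‖w‖⁻¹) (w - z)) (Metric.ball c r) := h1.integrableOn
  refine h2.congr_fun (fun w hw => ?_) Metric.isOpen_ball.measurableSet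
  simp only
  rw [Set.indicator_of_mem]
  rw [mem_ball_zero_iff]
  rw [mem_ball_iff_norm] at hw
  calc ‖w - z‖ = ‖(w - c) + (c - z)‖ := by ring_nf
    _ ≤ ‖w - c‖ + ‖c - z‖ := norm_add_le _ _
    _ < _ := by linarith

lemma exists_dbar_bound {H : ℂ → ℂ} (hH : ContDiff ℝ 1 H) (c : ℂ) (r : ℝ) :
    ∃ M, 0 ≤ M ∧ ∀ w ∈ Metric.closedBall c r, ‖dbar H w‖ ≤ M := by
  obtain ⟨M, hM⟩ := (isCompact_closedBall c r).exists_bound_of_continuousOn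
    (continuous_dbar hH).continuousOn
  exact ⟨max M 0, le_max_right _ _, fun w hw => (hM w hw).trans (le_max_left _ _)⟩

lemma integrableOn_dbar_div {H : ℂ → ℂ} (hH : ContDiff ℝ 1 H) (c z : ℂ) (r : ℝ) :
    IntegrableOn (fun w => dbar H w / (w - z)) (Metric.ball c r) := by
  obtain ⟨M, hM0, hM⟩ := exists_dbar_bound hH c r
  refine Integrable.mono' ((integrableOn_inv_norm c z r).const_mul M) ?_ ?_
  · exact ((continuous_dbar hH).measurable.div
      (measurable_id.sub_const z)).aestronglyMeasurable
  · refine (ae_restrict_iff' Metric.isOpen_ball.measurableSet).2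
      (Filter.Eventually.of_forall fun w hw => ?_)
    rw [norm_div, div_eq_mul_inv]
    gcongr
    exact hM w (Metric.ball_subset_closedBall hw)

lemma key_limit {H : ℂ → ℂ} (hH : ContDiff ℝ 1 H) (c : ℂ) {r : ℝ} (hr : 0 ≤ r) {z : ℂ}
    (hz : z ∉ Metric.sphere c r) {L : ℝ} (hL0 : 0 ≤ L)
    (hL : ∀ w ∈ Metric.closedBall c r, ‖H w‖ ≤ L * ‖w - z‖) :
    (∮ w in C(c, r), H w / (w - z)) = 2 * I * ∫ w in Metric.ball c r, dbar H w / (w - z) := by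
  have hst : ∀ ε : ℝ, 0 < ε → (∮ w in C(c, r), H w * regKernel z ε w) =
      2 * I * ∫ w in Metric.ball c r, (dbar H w * regKernel z ε w +
        H w * (ε / ((starRingEnd ℂ) (w - z) * (w - z) + ε) ^ 2)) := by
    intro ε hε
    have hK := contDiff_regKernel z hε
    rw [stokes_disc (hH.mul hK) c hr]
    congr 2
    funext w
    rw [dbar_mul (hH.differentiable (by norm_num) w) (hK.differentiable (by norm_num) w),
      dbar_regKernel z hε]
  have hpos : ∀ᶠ ε : ℝ in nhdsWithin 0 (Set.Ioi 0), 0 < ε := self_mem_nhdsWithin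
  have hlim1 : Filter.Tendsto (fun ε : ℝ => ∮ w in C(c, r), H w * regKernel z ε w)
      (nhdsWithin 0 (Set.Ioi 0)) (nhds (∮ w in C(c, r), H w / (w - z))) := by
    unfold circleIntegral
    refine intervalIntegral.tendsto_integral_filter_of_dominated_convergence
      (fun _ => r * L) ?_ ?_ (by simp) ?_
    · filter_upwards [hpos] with ε hε
      have h1 := (contDiff_regKernel z hε).continuous
      have h2 := hH.continuous
      simp only [deriv_circleMap]
      apply Continuous.aestronglyMeasurable
      have h3 := continuous_circleMap c r
      have h4 := continuous_circleMap 0 r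
      fun_prop
    · filter_upwards [hpos] with ε hε
      refine Filter.Eventually.of_forall fun θ _ => ?_
      have hmem := circleMap_mem_sphere c hr θ
      have hb := hL _ (Metric.sphere_subset_closedBall hmem)
      have hk := norm_regKernel_le z hε (circleMap c r θ)
      have hne : 0 < ‖circleMap c r θ - z‖ := by
        rw [norm_pos_iff, sub_ne_zero]
        rintro rfl
        exact hz hmem
      rw [norm_smul, norm_mul]
      have : ‖deriv (circleMap c r) θ‖ = r := by simp [abs_of_nonneg hr]
      rw [this]
      gcongr
      calc _ ≤ (L * ‖circleMap c r θ - z‖) * ‖circleMap c r θ - z‖⁻¹ := by gcongr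
        _ = L := by field_simp
    · refine Filter.Eventually.of_forall fun θ _ => ?_
      have hne : circleMap c r θ ≠ z := by
        rintro rfl
        exact hz (circleMap_mem_sphere c hr θ)
      simp only
      rw [div_eq_mul_one_div]
      exact ((tendsto_regKernel hne).const_mul _).const_smul _
  obtain ⟨M, hM0, hM⟩ := exists_dbar_bound hH c r
  have hlim2 : Filter.Tendsto (fun ε : ℝ => ∫ w in Metric.ball c r, (dbar H w * regKernel z ε w +
        H w * ((ε : ℂ) / ((starRingEnd ℂ) (w - z) * (w - z) + ε) ^ 2)))
      (nhdsWithin 0 (Set.Ioi 0)) (nhds (∫ w in Metric.ball c r, dbar H w / (w - z))) := by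
    refine tendsto_integral_filter_of_dominated_convergence
      (fun w => M * ‖w - z‖⁻¹ + L * ‖w - z‖⁻¹) ?_ ?_ ?_ ?_
    · filter_upwards [hpos] with ε hε
      have h1 := (contDiff_regKernel z hε).continuous
      have h2 := hH.continuous
      have h3 := continuous_dbar hH
      have h4 : Continuous fun w : ℂ =>
          ((ε : ℂ) / ((starRingEnd ℂ) (w - z) * (w - z) + ε) ^ 2) := by
        apply Continuous.div (by fun_prop)
        · have : Continuous fun w : ℂ => (starRingEnd ℂ) (w - z) :=
            Complex.continuous_conj.comp (by fun_prop)
          fun_prop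
        · exact fun w => pow_ne_zero 2 (regDen_ne z hε w)
      apply Continuous.aestronglyMeasurable
      fun_prop
    · filter_upwards [hpos] with ε hε
      refine (ae_restrict_iff' Metric.isOpen_ball.measurableSet).2
        (Filter.Eventually.of_forall fun w hw => ?_)
      have hw' := Metric.ball_subset_closedBall hw
      refine (norm_add_le _ _).trans (add_le_add ?_ ?_)
      · rw [norm_mul]
        have := hM w hw'
        have := norm_regKernel_le z hε w
        gcongr
      · exact norm_regErr_le z hε w hL0 (hL w hw')
    · exact ((integrableOn_inv_norm c z r).const_mul M).add
        ((integrableOn_inv_norm c z r).const_mul L)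
    · have hae : ∀ᵐ w : ℂ ∂(volume.restrict (Metric.ball c r)), w ≠ z :=
        ae_restrict_of_ae (Measure.ae_ne volume z)
      filter_upwards [hae] with w hw
      have := ((tendsto_regKernel hw).const_mul (dbar H w)).add (tendsto_regErr hw (H w))
      simpa [div_eq_mul_inv] using this
  have hlim2' := hlim2.const_mul (2 * I)
  refine tendsto_nhds_unique hlim1 (hlim2'.congr' ?_)
  filter_upwards [hpos] with ε hε
  exact (hst ε hε).symm

lemma pompeiu_outside {G : ℂ → ℂ} (hG : ContDiff ℝ 1 G) (c : ℂ) {r : ℝ} (hr : 0 ≤ r) {z : ℂ}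
    (hz : z ∉ Metric.closedBall c r) :
    (∮ w in C(c, r), G w / (w - z)) = 2 * I * ∫ w in Metric.ball c r, dbar G w / (w - z) := by
  have hne : ∀ w ∈ Metric.closedBall c r, w - z ≠ 0 := by
    intro w hw h
    exact hz (sub_eq_zero.1 h ▸ hw)
  obtain ⟨M, hM⟩ := (isCompact_closedBall c r).exists_bound_of_continuousOn
    (f := fun w => G w / (w - z))
    (hG.continuous.continuousOn.div (by fun_prop) hne)
  refine key_limit hG c hr (fun h => hz (Metric.sphere_subset_closedBall h))
    (le_max_right M 0) fun w hw => ?_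
  have h1 := hM w hw
  have h2 : 0 < ‖w - z‖ := norm_pos_iff.2 (hne w hw)
  rw [norm_div, div_le_iff₀ h2] at h1
  exact h1.trans (by gcongr; exact le_max_left _ _)

lemma pompeiu_inside {G : ℂ → ℂ} (hG : ContDiff ℝ 1 G) (c : ℂ) {r : ℝ} {z : ℂ}
    (hz : z ∈ Metric.ball c r) :
    (∮ w in C(c, r), G w / (w - z)) = 2 * Real.pi * I * G z +
      2 * I * ∫ w in Metric.ball c r, dbar G w / (w - z) := by
  have hr : 0 < r := Metric.pos_of_mem_ball hz
  have hzs : z ∉ Metric.sphere c r := by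
    intro h
    rw [Metric.mem_sphere] at h
    rw [Metric.mem_ball] at hz
    linarith
  obtain ⟨M, hM⟩ := (isCompact_closedBall c r).exists_bound_of_continuousOn
    (hG.continuous_fderiv (by norm_num)).continuousOn
  have hk := key_limit (H := fun w => G w - G z) (hG.sub contDiff_const) c hr.le hzs
    (le_max_right M 0) (fun w hw => by
      have := Convex.norm_image_sub_le_of_norm_fderiv_le (𝕜 := ℝ) (f := G) (C := max M 0)
        (s := Metric.closedBall c r)
        (fun x _ => hG.differentiable (by norm_num) x)
        (fun x hx => (hM x hx).trans (le_max_left _ _)) (convex_closedBall c r)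
        (Metric.ball_subset_closedBall hz) hw
      exact this)
  have hd : ∀ w, dbar (fun w => G w - G z) w = dbar G w := by
    intro w
    simp only [dbar, fderiv_sub_const]
  simp only [hd] at hk
  rw [← hk]
  have hne : ∀ w ∈ Metric.sphere c r, w - z ≠ 0 := by
    intro w hw h
    exact hzs (sub_eq_zero.1 h ▸ hw)
  have hsplit : (∮ w in C(c, r), (G w - G z) / (w - z)) =
      (∮ w in C(c, r), G w / (w - z)) - ∮ w in C(c, r), G z * (w - z)⁻¹ := by
    rw [← circleIntegral.integral_sub]
    · congr 1; funext w; rw [sub_div, div_eq_mul_inv (G z)]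
    · exact (hG.continuous.continuousOn.div (by fun_prop) hne).circleIntegrable hr.le
    · exact (continuousOn_const.mul ((by fun_prop : ContinuousOn (fun w => w - z) _).inv₀
        hne)).circleIntegrable hr.le
  rw [hsplit, circleIntegral.integral_const_mul, circleIntegral.integral_sub_inv_of_mem_ball hz]
  ring

lemma differentiableAt_cauchy {g : ℂ → ℂ} {c : ℂ} {r : ℝ} (hr : 0 ≤ r)
    (hg : ContinuousOn g (Metric.sphere c r)) {z : ℂ} (hz : z ∉ Metric.sphere c r) :
    DifferentiableAt ℂ (fun z => ∮ w in C(c, r), g w / (w - z)) z := by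
  have hopen : IsOpen (Metric.sphere c r)ᶜ := Metric.isClosed_sphere.isOpen_compl
  obtain ⟨δ, hδ, hball⟩ := Metric.isOpen_iff.1 hopen z hz
  have hfar : ∀ x ∈ Metric.ball z (δ / 2), ∀ w ∈ Metric.sphere c r, δ / 2 ≤ ‖w - x‖ := by
    intro x hx w hw
    by_contra! hlt
    refine hball (a := w) ?_ hw
    rw [Metric.mem_ball] at hx ⊢
    rw [← dist_eq_norm] at hlt
    linarith [dist_triangle w x z]
  have hmem := circleMap_mem_sphere c hr
  have hne : ∀ x ∈ Metric.ball z (δ / 2), ∀ θ, circleMap c r θ - x ≠ 0 := by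
    intro x hx θ h
    have := hfar x hx _ (hmem θ)
    rw [h, norm_zero] at this
    linarith
  obtain ⟨M, hM⟩ := (isCompact_sphere c r).exists_bound_of_continuousOn hg
  have hgc : Continuous fun θ => g (circleMap c r θ) :=
    hg.comp_continuous (continuous_circleMap c r) hmem
  have hcm := continuous_circleMap c r
  have hcm0 := continuous_circleMap 0 r
  have hzb : z ∈ Metric.ball z (δ / 2) := Metric.mem_ball_self (by linarith)
  have hFc : ∀ x ∈ Metric.ball z (δ / 2),
      Continuous fun θ => deriv (circleMap c r) θ • (g (circleMap c r θ) / (circleMap c r θ - x)) := by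
    intro x hx
    simp only [deriv_circleMap]
    have : Continuous fun θ => g (circleMap c r θ) / (circleMap c r θ - x) :=
      hgc.div (by fun_prop) (hne x hx)
    fun_prop
  have hF'c : Continuous fun θ =>
      deriv (circleMap c r) θ • (g (circleMap c r θ) / (circleMap c r θ - z) ^ 2) := by
    simp only [deriv_circleMap]
    have : Continuous fun θ => g (circleMap c r θ) / (circleMap c r θ - z) ^ 2 :=
      hgc.div (by fun_prop) (fun θ => pow_ne_zero 2 (hne z hzb θ))
    fun_prop
  have := intervalIntegral.hasDerivAt_integral_of_dominated_loc_of_deriv_le (μ := volume)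
    (a := 0) (b := 2 * Real.pi) (s := Metric.ball z (δ / 2)) (x₀ := z)
    (F := fun x θ => deriv (circleMap c r) θ • (g (circleMap c r θ) / (circleMap c r θ - x)))
    (F' := fun x θ => deriv (circleMap c r) θ • (g (circleMap c r θ) / (circleMap c r θ - x) ^ 2))
    (bound := fun _ => r * (max M 0 / (δ / 2) ^ 2))
    (Metric.ball_mem_nhds z (by linarith))
    (by
      filter_upwards [Metric.ball_mem_nhds z (by linarith : 0 < δ / 2)] with x hx
      exact (hFc x hx).aestronglyMeasurable)
    ((hFc z hzb).intervalIntegrable _ _) hF'c.aestronglyMeasurable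
    (by
      refine Filter.Eventually.of_forall fun θ _ x hx => ?_
      have h1 := hfar x hx _ (hmem θ)
      have h2 : ‖g (circleMap c r θ)‖ ≤ max M 0 := (hM _ (hmem θ)).trans (le_max_left _ _)
      have h3 : ‖deriv (circleMap c r) θ‖ = r := by simp [abs_of_nonneg hr]
      rw [norm_smul, h3, norm_div, norm_pow]
      gcongr)
    (by simp)
    (by
      refine Filter.Eventually.of_forall fun θ _ x hx => ?_
      have h1 : HasDerivAt (fun x => circleMap c r θ - x) (-1) x := (hasDerivAt_id x).const_sub _
      have h2 := (h1.fun_inv (hne x hx θ)).const_mul (g (circleMap c r θ))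
      have h3 := h2.const_smul (deriv (circleMap c r) θ)
      rw [neg_neg, mul_one_div] at h3
      exact h3)
  exact this.2.differentiableAt

lemma tendsto_cauchyMinus {g : ℂ → ℂ} {c : ℂ} {r : ℝ} (hr : 0 ≤ r)
    (hg : ContinuousOn g (Metric.sphere c r)) :
    Filter.Tendsto (cauchyMinus c r g) (Bornology.cobounded ℂ) (nhds 0) := by
  obtain ⟨M, hM⟩ := (isCompact_sphere c r).exists_bound_of_continuousOn hg
  have hlim : Filter.Tendsto (fun z : ℂ => r * (max M 0 / (‖z‖ - (‖c‖ + r))))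
      (Bornology.cobounded ℂ) (nhds 0) := by
    have h1 : Filter.Tendsto (fun z : ℂ => ‖z‖ - (‖c‖ + r)) (Bornology.cobounded ℂ) Filter.atTop :=
      Filter.tendsto_atTop_add_const_right _ _ tendsto_norm_cobounded_atTop
    have := (h1.const_div_atTop (max M 0)).const_mul r
    simpa using this
  refine squeeze_zero_norm' ?_ hlim
  have hev : ∀ᶠ z : ℂ in Bornology.cobounded ℂ, ‖c‖ + r < ‖z‖ :=
    tendsto_norm_cobounded_atTop.eventually_gt_atTop _
  filter_upwards [hev] with z hz
  unfold cauchyMinus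
  rw [norm_neg]
  have := circleIntegral.norm_two_pi_i_inv_smul_integral_le_of_norm_le_const (c := c)
    (f := fun w => g w / (w - z)) (C := max M 0 / (‖z‖ - (‖c‖ + r))) hr (by
      intro w hw
      have h1 : ‖w‖ ≤ ‖c‖ + r := by
        have := norm_add_le c (w - c)
        rw [add_sub_cancel, mem_sphere_iff_norm.1 hw] at this
        exact this
      have h2 : ‖z‖ - ‖w‖ ≤ ‖w - z‖ := by
        rw [norm_sub_rev]; exact norm_sub_norm_le z w
      rw [norm_div]
      have h3 : ‖g w‖ ≤ max M 0 := (hM w hw).trans (le_max_left _ _)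
      have h4 : 0 < ‖z‖ - (‖c‖ + r) := by linarith
      gcongr
      linarith)
  rw [smul_eq_mul, inv_eq_one_div] at this
  exact this

open scoped Manifold ContDiff in
lemma exists_global_ext {g : ℂ → ℂ} {U K : Set ℂ} (hU : IsOpen U) (hK : IsClosed K) (hKU : K ⊆ U)
    (hg : ContDiffOn ℝ 1 g U) :
    ∃ G : ℂ → ℂ, ContDiff ℝ 1 G ∧ ∀ x ∈ K, G =ᶠ[nhds x] g := by
  obtain ⟨χ, h0, h1, -⟩ := exists_contMDiffMap_zero_one_nhds_of_isClosed (n := 1) 𝓘(ℝ, ℂ)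
    (s := Uᶜ) (t := K) hU.isClosed_compl hK
    (Set.disjoint_left.2 fun x hx hxK => hx (hKU hxK))
  have hχ : ContDiff ℝ 1 χ := χ.contMDiff.contDiff
  refine ⟨fun x => (χ x : ℂ) * g x, ?_, ?_⟩
  · rw [contDiff_iff_contDiffAt]
    intro x
    by_cases hx : x ∈ U
    · have hgx := hg.contDiffAt (hU.mem_nhds hx)
      have hχx : ContDiffAt ℝ 1 (fun x => (χ x : ℂ)) x :=
        (Complex.ofRealCLM.contDiff.comp hχ).contDiffAt
      exact hχx.mul hgx
    · have := (eventually_nhdsSet_iff_forall.1 h0) x hx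
      refine (contDiffAt_const (c := (0 : ℂ))).congr_of_eventuallyEq ?_
      filter_upwards [this] with y hy
      simp [hy]
  · intro x hx
    have := (eventually_nhdsSet_iff_forall.1 h1) x hx
    filter_upwards [this] with y hy
    simp [hy]

lemma sphere_subset_closure_outer {R : ℝ} (hR : 0 < R) {n : ℕ} {p : Fin n → ℂ} {r : Fin n → ℝ}
    (hsub : ∀ i, Metric.closedBall (p i) (r i) ⊆ Metric.ball (0 : ℂ) R) :
    Metric.sphere (0 : ℂ) R ⊆
      closure (Metric.ball (0 : ℂ) R \ ⋃ i, Metric.closedBall (p i) (r i)) := by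
  intro w hw
  have hV : IsOpen (⋃ i, Metric.closedBall (p i) (r i))ᶜ :=
    (isClosed_iUnion_of_finite fun i => Metric.isClosed_closedBall).isOpen_compl
  rw [Set.sdiff_eq, Set.inter_comm]
  apply hV.inter_closure
  refine ⟨?_, ?_⟩
  · simp only [Set.mem_compl_iff, Set.mem_iUnion, not_exists]
    intro i hi
    have h1 := hsub i hi
    rw [Metric.mem_ball] at h1
    rw [Metric.mem_sphere] at hw
    linarith
  · rw [closure_ball _ hR.ne']
    exact Metric.sphere_subset_closedBall hw

lemma sphere_subset_closure_inner {R : ℝ} {n : ℕ} {p : Fin n → ℂ} {r : Fin n → ℝ}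
    (hr : ∀ i, 0 < r i)
    (hdisj : Pairwise fun i j =>
      Disjoint (Metric.closedBall (p i) (r i)) (Metric.closedBall (p j) (r j)))
    (hsub : ∀ i, Metric.closedBall (p i) (r i) ⊆ Metric.ball (0 : ℂ) R) (i : Fin n) :
    Metric.sphere (p i) (r i) ⊆
      closure (Metric.ball (0 : ℂ) R \ ⋃ i, Metric.closedBall (p i) (r i)) := by
  intro w hw
  have hwc := Metric.sphere_subset_closedBall hw
  have hV : IsOpen (Metric.ball (0 : ℂ) R ∩
      (⋃ j : {j // j ≠ i}, Metric.closedBall (p j) (r j))ᶜ) :=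
    Metric.isOpen_ball.inter
      (isClosed_iUnion_of_finite fun i => Metric.isClosed_closedBall).isOpen_compl
  have hmem : w ∈ (Metric.ball (0 : ℂ) R ∩
      (⋃ j : {j // j ≠ i}, Metric.closedBall (p j) (r j))ᶜ) ∩
      closure (Metric.closedBall (p i) (r i))ᶜ := by
    refine ⟨⟨hsub i hwc, ?_⟩, ?_⟩
    · simp only [Set.mem_compl_iff, Set.mem_iUnion, not_exists]
      rintro ⟨j, hj⟩ hwj
      exact Set.disjoint_left.1 (hdisj hj) hwj hwc
    · rw [closure_compl, interior_closedBall _ (hr i).ne']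
      intro h
      rw [Metric.mem_ball] at h
      rw [Metric.mem_sphere] at hw
      linarith
  refine closure_mono ?_ (hV.inter_closure hmem)
  rintro v ⟨⟨hv1, hv2⟩, hv3⟩
  refine ⟨hv1, ?_⟩
  simp only [Set.mem_compl_iff, Set.mem_iUnion, not_exists] at hv2 ⊢
  intro j hj
  by_cases hji : j = i
  · subst hji; exact hv3 hj
  · exact hv2 ⟨j, hji⟩ hj

/-- A Laurent-type Cauchy–Pompeiu decomposition for `C¹` functions on a disk with
finitely many disjoint closed disks removed. -/
theorem cauchy_pompeiu_laurent (R : ℝ) (hR : 0 < R) (n : ℕ) (p : Fin n → ℂ)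
    (r : Fin n → ℝ) (hr : ∀ i, 0 < r i)
    (hdisj : Pairwise fun i j =>
      Disjoint (Metric.closedBall (p i) (r i)) (Metric.closedBall (p j) (r j)))
    (hsub : ∀ i, Metric.closedBall (p i) (r i) ⊆ Metric.ball (0 : ℂ) R)
    (Ω : Set ℂ) (hΩ : Ω = Metric.ball (0 : ℂ) R \ ⋃ i, Metric.closedBall (p i) (r i))
    (g : ℂ → ℂ) (U : Set ℂ) (hU : IsOpen U) (hclos : closure Ω ⊆ U)
    (hg : ContDiffOn ℝ 1 g U) :
    DifferentiableOn ℂ (cauchyPlus R g) (Metric.ball (0 : ℂ) R) ∧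
    (∀ i, DifferentiableOn ℂ (cauchyMinus (p i) (r i) g)
        (Metric.closedBall (p i) (r i))ᶜ ∧
      Filter.Tendsto (cauchyMinus (p i) (r i) g) (Bornology.cobounded ℂ) (nhds 0)) ∧
    ∀ z ∈ Ω, g z = cauchyPlus R g z + ∑ i, cauchyMinus (p i) (r i) g z -
      (1 / (Real.pi : ℂ)) * ∫ w in Ω, dbar g w / (w - z) := by
  have hS0 : Metric.sphere (0 : ℂ) R ⊆ closure Ω := hΩ ▸ sphere_subset_closure_outer hR hsub
  have hSi : ∀ i, Metric.sphere (p i) (r i) ⊆ closure Ω :=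
    fun i => hΩ ▸ sphere_subset_closure_inner hr hdisj hsub i
  have hgc : ContinuousOn g U := hg.continuousOn
  refine ⟨?_, fun i => ⟨?_, ?_⟩, ?_⟩
  · intro z hz
    refine DifferentiableAt.differentiableWithinAt ?_
    unfold cauchyPlus
    refine (differentiableAt_cauchy hR.le (hgc.mono (hS0.trans hclos)) fun h => ?_).const_mul _
    rw [Metric.mem_ball] at hz
    rw [Metric.mem_sphere] at h
    linarith
  · intro z hz
    refine DifferentiableAt.differentiableWithinAt ?_
    unfold cauchyMinus
    exact ((differentiableAt_cauchy (hr i).le (hgc.mono ((hSi i).trans hclos)) fun h =>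
      hz (Metric.sphere_subset_closedBall h)).const_mul _).neg
  · exact tendsto_cauchyMinus (hr i).le (hgc.mono ((hSi i).trans hclos))
  intro z hz
  obtain ⟨G, hG, hGg⟩ := exists_global_ext hU isClosed_closure hclos hg
  have hGeq : ∀ w ∈ closure Ω, G w = g w := fun w hw => (hGg w hw).eq_of_nhds
  have hzΩ := hz
  rw [hΩ] at hz
  have hzi : ∀ i, z ∉ Metric.closedBall (p i) (r i) := by
    intro i h
    exact hz.2 (Set.mem_iUnion.2 ⟨i, h⟩)
  have h0 := pompeiu_inside hG 0 hz.1
  have hi := fun i => pompeiu_outside hG (p i) (hr i).le (hzi i)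
  have c0 : (∮ w in C(0, R), G w / (w - z)) = ∮ w in C(0, R), g w / (w - z) :=
    circleIntegral.integral_congr hR.le fun w hw => by simp only [hGeq w (hS0 hw)]
  have ci : ∀ i, (∮ w in C(p i, r i), G w / (w - z)) = ∮ w in C(p i, r i), g w / (w - z) :=
    fun i => circleIntegral.integral_congr (hr i).le fun w hw => by
      simp only [hGeq w (hSi i hw)]
  have hΩm : MeasurableSet Ω := by
    rw [hΩ]
    exact measurableSet_ball.diff (MeasurableSet.iUnion fun i => measurableSet_closedBall)
  have hdb : (∫ w in Ω, dbar g w / (w - z)) = ∫ w in Ω, dbar G w / (w - z) := by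
    refine setIntegral_congr_fun hΩm fun w hw => ?_
    simp only [dbar, (hGg w (subset_closure hw)).fderiv_eq]
  have hint := integrableOn_dbar_div hG 0 z R
  have hdiff : (∫ w in Ω, dbar G w / (w - z)) = (∫ w in Metric.ball 0 R, dbar G w / (w - z)) -
      ∑ i, ∫ w in Metric.ball (p i) (r i), dbar G w / (w - z) := by
    rw [hΩ, setIntegral_sdiff (MeasurableSet.iUnion fun i => measurableSet_closedBall) hint
      (Set.iUnion_subset hsub), integral_iUnion_fintype
        (fun i => measurableSet_closedBall) hdisj (fun i => hint.mono_set (hsub i))]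
    congr 1
    refine Finset.sum_congr rfl fun i _ => ?_
    exact setIntegral_congr_set (ae_eq_of_subset_of_measure_ge
      Metric.ball_subset_closedBall (Measure.addHaar_closedBall_eq_addHaar_ball volume _ _).le
      measurableSet_ball.nullMeasurableSet measure_closedBall_lt_top.ne).symm
  have hzG := hGeq z (subset_closure hzΩ)
  rw [c0, hzG] at h0
  simp only [ci] at hi
  rw [hdb, hdiff]
  unfold cauchyPlus cauchyMinus
  simp only [hi, h0]
  have hpi : (Real.pi : ℂ) ≠ 0 := by exact_mod_cast Real.pi_ne_zero
  have hterm : ∀ A : ℂ, 1 / (2 * Real.pi * I) * (2 * I * A) = 1 / Real.pi * A := by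
    intro A
    field_simp
  simp only [mul_add, hterm, Finset.sum_neg_distrib, ← Finset.mul_sum]
  field_simp
  ring
end
end

section
/- Let m ≥ 1, let c₀, c₁, …, c_m be real numbers, and let 0 < y₁ < y₂ < … < y_m be real numbers. Define, for z in the upper half plane minus the points I·y_i, F(z) = c₀/(2·I·z) − Σ_{i=1}^m (c_i/(2z)) · ( 1/(Complex.log z − Complex.log(I·y_i)) − 1/(Complex.log z − Complex.log(−I·y_i)) ). Then there exists ε₀ > 0 such that for all ε with 0 < ε < ε₀: −Re ∮_{C(I·y₁, ε)} F(z)²·(1 − z²) dz = (π(y₁² + 1)/(2y₁)) · ( c₁²·(1 − y₁²)/(y₁² + 1) − Σ_{i=2}^m 2π²·c₁·c_i / ((Real.log y₁ − Real.log y_i)·((Real.log y₁ − Real.log y_i)² + π²)) ). -/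
noncomputable section

open Complex

/-- The derivative `ũ_z` of `ũ(z) = c₀·arg z + Σᵢ cᵢ·h_{pᵢ}(z)` with `pᵢ = I·yᵢ`. -/
def Fderiv12 (m : ℕ) (c₀ : ℝ) (c : Fin m → ℝ) (y : Fin m → ℝ) (z : ℂ) : ℂ :=
  (c₀ : ℂ) / (2 * Complex.I * z) -
    ∑ i, ((c i : ℂ) / (2 * z)) *
      (1 / (Complex.log z - Complex.log (Complex.I * (y i : ℂ))) -
        1 / (Complex.log z - Complex.log (-Complex.I * (y i : ℂ))))

open Complex Topology Filter Metric

lemma aux_k {p : ℂ} (hp : p ∈ Complex.slitPlane) :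
    AnalyticAt ℂ (dslope Complex.log p) p ∧ dslope Complex.log p p = 1 / p ∧
      HasDerivAt (dslope Complex.log p) (-1 / (2 * p ^ 2)) p := by
  have hp0 : p ≠ 0 := Complex.slitPlane_ne_zero hp
  have hL : AnalyticAt ℂ Complex.log p := analyticAt_clog hp
  have hk : AnalyticAt ℂ (dslope Complex.log p) p := by
    obtain ⟨q, hq⟩ := hL
    exact ⟨_, hq.has_fpower_series_dslope_fslope⟩
  set k := dslope Complex.log p with hkdef
  have hd : deriv Complex.log p = 1 / p := by
    rw [(Complex.hasDerivAt_log hp).deriv, one_div]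
  have hkp : k p = 1 / p := by rw [hkdef, dslope_same, hd]
  refine ⟨hk, hkp, ?_⟩
  have hev : (fun z : ℂ => z⁻¹) =ᶠ[𝓝 p] fun z => k z + (z - p) * deriv k z := by
    filter_upwards [hk.eventually_analyticAt, Complex.isOpen_slitPlane.mem_nhds hp] with z hz hs
    have h1 : HasDerivAt (fun w => Complex.log w - Complex.log p) z⁻¹ z :=
      (Complex.hasDerivAt_log hs).sub_const _
    have h2 : HasDerivAt (fun w => (w - p) * k w) (1 * k z + (z - p) * deriv k z) z :=
      ((hasDerivAt_id z).sub_const p).mul hz.differentiableAt.hasDerivAt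
    have h3 : (fun w => (w - p) * k w) = fun w => Complex.log w - Complex.log p := by
      funext w
      exact sub_smul_dslope Complex.log p w
    rw [h3] at h2
    simpa using h1.unique h2
  have hk' := hk.differentiableAt.hasDerivAt
  have h4 : HasDerivAt (fun z => k z + (z - p) * deriv k z)
      (deriv k p + (1 * deriv k p + (p - p) * deriv (deriv k) p)) p :=
    hk'.add (((hasDerivAt_id p).sub_const p).mul hk.deriv.differentiableAt.hasDerivAt)
  have h5 := (hasDerivAt_inv hp0).congr_of_eventuallyEq hev.symm
  have h6 := h5.unique h4
  have : deriv k p = -1 / (2 * p ^ 2) := by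
    have : 2 * deriv k p = -(p ^ 2)⁻¹ := by rw [h6]; ring
    field_simp
    field_simp at this
    linear_combination this
  rwa [this] at hk'

lemma aux_integral {p : ℂ} (hp : p ∈ Complex.slitPlane) (a : ℂ) (G : ℂ → ℂ)
    (hG : AnalyticAt ℂ G p) :
    ∃ ε₀ : ℝ, 0 < ε₀ ∧ ∀ ε : ℝ, 0 < ε → ε < ε₀ →
      (∮ z in C(p, ε), (-(a / (2 * z) * (1 / (Complex.log z - Complex.log p))) + G z) ^ 2 *
        (1 - z ^ 2)) =
      2 * Real.pi * Complex.I * (-a ^ 2 / 4 * (1 / p + p) - a * (1 - p ^ 2) * G p) := by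
  have hp0 : p ≠ 0 := Complex.slitPlane_ne_zero hp
  obtain ⟨hk, hkp, hk'⟩ := aux_k hp
  have hmul : ∀ w, (w - p) * dslope Complex.log p w = Complex.log w - Complex.log p :=
    fun w => sub_smul_dslope Complex.log p w
  set k := dslope Complex.log p with hkdef
  have hkp0 : k p ≠ 0 := by rw [hkp]; exact one_div_ne_zero hp0
  set H : ℂ → ℂ := fun z => (-(a / (2 * z * k z)) + (z - p) * G z) ^ 2 * (1 - z ^ 2) with hH
  have hden : 2 * p * k p ≠ 0 := mul_ne_zero (mul_ne_zero two_ne_zero hp0) hkp0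
  have hHan : AnalyticAt ℂ H p := by
    rw [hH]
    have : AnalyticAt ℂ (fun z => a / (2 * z * k z)) p :=
      AnalyticAt.div analyticAt_const ((analyticAt_const.mul analyticAt_id).mul hk) hden
    exact ((this.neg.add ((analyticAt_id.sub analyticAt_const).mul hG)).pow 2).mul
      (analyticAt_const.sub (analyticAt_id.pow 2))
  have hH' : HasDerivAt H (-a ^ 2 / 4 * (1 / p + p) - a * (1 - p ^ 2) * G p) p := by
    have h1 : HasDerivAt (fun z => 2 * z * k z) (2 * 1 * k p + 2 * p * (-1 / (2 * p ^ 2))) p :=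
      ((hasDerivAt_id p).const_mul 2).mul hk'
    have h2 := (hasDerivAt_const p a).div h1 hden
    have h3 := ((hasDerivAt_id p).sub_const p).mul hG.differentiableAt.hasDerivAt
    have h4 := ((h2.neg.add h3).pow 2).mul (((hasDerivAt_id p).pow 2).const_sub 1)
    refine HasDerivAt.congr_deriv (f := H) h4 ?_
    simp [hkp]
    field_simp
    ring
  obtain ⟨r, hr, hball⟩ := Metric.eventually_nhds_iff_ball.1 hHan.eventually_analyticAt
  refine ⟨r, hr, fun ε hε hεr => ?_⟩
  have hdiff : DifferentiableOn ℂ H (closedBall p ε) := fun z hz =>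
    (hball z (closedBall_subset_ball hεr hz)).differentiableAt.differentiableWithinAt
  have hC := hdiff.deriv_eq_smul_circleIntegral hε
  rw [hH'.deriv, smul_eq_mul] at hC
  rw [← hC]
  refine circleIntegral.integral_congr hε.le fun z hz => ?_
  have hz0 : z - p ≠ 0 := by
    rw [sub_ne_zero]
    rintro rfl
    simp at hz
    exact hε.ne hz
  simp only [hH, smul_eq_mul, ← hmul]
  have e : -(a / (2 * z * k z)) + (z - p) * G z
      = (z - p) * (-(a / (2 * z) * (1 / ((z - p) * k z))) + G z) := by
    have : a / (2 * z) * (1 / ((z - p) * k z)) = (z - p)⁻¹ * (a / (2 * z * k z)) := by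
      simp only [div_eq_mul_inv, mul_inv]; ring
    rw [this, mul_add, mul_neg, mul_inv_cancel_left₀ hz0]
  rw [e]
  field_simp

lemma aux_logI {y : ℝ} (hy : 0 < y) :
    Complex.log (Complex.I * y) = Real.log y + Real.pi / 2 * Complex.I := by
  rw [Complex.log_mul_ofReal _ hy _ Complex.I_ne_zero, Complex.log_I]

lemma aux_logNegI {y : ℝ} (hy : 0 < y) :
    Complex.log (-Complex.I * y) = Real.log y - Real.pi / 2 * Complex.I := by
  rw [Complex.log_mul_ofReal _ hy _ (neg_ne_zero.2 Complex.I_ne_zero), Complex.log_neg_I]; ring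

lemma aux_add_ne (d : ℝ) : (d : ℂ) + Real.pi * Complex.I ≠ 0 := by
  intro h
  have := congrArg Complex.im h
  simp [Real.pi_ne_zero] at this

lemma aux_term (Y ci d : ℝ) (hY : Y ≠ 0) (hd : d ≠ 0) :
    (ci : ℂ) / (2 * (Complex.I * Y)) * (1 / (d : ℂ) - 1 / ((d : ℂ) + Real.pi * Complex.I)) =
      ((ci * Real.pi / (2 * Y * (d ^ 2 + Real.pi ^ 2)) : ℝ) : ℂ) -
      ((ci * Real.pi ^ 2 / (2 * Y * (d * (d ^ 2 + Real.pi ^ 2))) : ℝ) : ℂ) * Complex.I := by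
  have h1 := aux_add_ne d
  have h2 : (d : ℂ) ≠ 0 := by exact_mod_cast hd
  have h3 : (Y : ℂ) ≠ 0 := by exact_mod_cast hY
  have h4 : (d : ℂ) ^ 2 + (Real.pi : ℂ) ^ 2 ≠ 0 := by
    have := Real.pi_pos
    exact_mod_cast (by positivity : d ^ 2 + Real.pi ^ 2 ≠ 0)
  have hI := Complex.I_sq
  have hI0 := Complex.I_ne_zero
  push_cast
  rw [div_sub_div _ _ h2 h1, div_mul_div_comm, ← sub_eq_zero]
  field_simp
  ring_nf
  simp only [show Complex.I ^ 3 = -Complex.I by rw [pow_succ, hI]; ring, hI]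
  ring

/-- The horizontal force (flux) computation at the lowest point `I·y₁`:
`−Re ∮_{C(I·y₁,ε)} F(z)²·(1 − z²) dz` equals the explicit balancing expression. -/
theorem force_at_lowest_point (m : ℕ) (hm : 0 < m) (c₀ : ℝ) (c : Fin m → ℝ)
    (y : Fin m → ℝ) (hypos : ∀ i, 0 < y i) (hmono : StrictMono y) :
    ∃ ε₀ : ℝ, 0 < ε₀ ∧ ∀ ε : ℝ, 0 < ε → ε < ε₀ →
      -(∮ z in C(Complex.I * (y ⟨0, hm⟩ : ℂ), ε),
          (Fderiv12 m c₀ c y z) ^ 2 * (1 - z ^ 2)).re =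
        Real.pi * ((y ⟨0, hm⟩) ^ 2 + 1) / (2 * y ⟨0, hm⟩) *
          ((c ⟨0, hm⟩) ^ 2 * (1 - (y ⟨0, hm⟩) ^ 2) / ((y ⟨0, hm⟩) ^ 2 + 1) -
            ∑ i ∈ Finset.univ.erase (⟨0, hm⟩ : Fin m),
              2 * Real.pi ^ 2 * c ⟨0, hm⟩ * c i /
                ((Real.log (y ⟨0, hm⟩) - Real.log (y i)) *
                  ((Real.log (y ⟨0, hm⟩) - Real.log (y i)) ^ 2 + Real.pi ^ 2))) := by
  set j : Fin m := ⟨0, hm⟩ with hj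
  have hY := hypos j
  have hYC : (y j : ℂ) ≠ 0 := by exact_mod_cast hY.ne'
  set p : ℂ := Complex.I * (y j : ℂ) with hpdef
  have hp0 : p ≠ 0 := mul_ne_zero Complex.I_ne_zero hYC
  have hp : p ∈ Complex.slitPlane := by
    rw [Complex.mem_slitPlane_iff]; right; simp [hpdef, hY.ne']
  have hlogp : Complex.log p = Real.log (y j) + Real.pi / 2 * Complex.I := aux_logI hY
  have hpos : ∀ i, Complex.log p - Complex.log (Complex.I * (y i : ℂ))
      = ((Real.log (y j) - Real.log (y i) : ℝ) : ℂ) := by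
    intro i; rw [hlogp, aux_logI (hypos i)]; push_cast; ring
  have hneg : ∀ i, Complex.log p - Complex.log (-Complex.I * (y i : ℂ))
      = ((Real.log (y j) - Real.log (y i) : ℝ) : ℂ) + Real.pi * Complex.I := by
    intro i; rw [hlogp, aux_logNegI (hypos i)]; push_cast; ring
  have hd : ∀ i, i ≠ j → Real.log (y j) - Real.log (y i) ≠ 0 := by
    intro i hi h
    exact hi (hmono.injective (Real.log_injOn_pos (hypos j) (hypos i) (sub_eq_zero.1 h))).symm
  set G : ℂ → ℂ := fun z => (c₀ : ℂ) / (2 * Complex.I * z) +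
    (c j : ℂ) / (2 * z) * (1 / (Complex.log z - Complex.log (-Complex.I * (y j : ℂ)))) -
    ∑ i ∈ Finset.univ.erase j, ((c i : ℂ) / (2 * z)) *
      (1 / (Complex.log z - Complex.log (Complex.I * (y i : ℂ))) -
        1 / (Complex.log z - Complex.log (-Complex.I * (y i : ℂ)))) with hGdef
  have hL : AnalyticAt ℂ Complex.log p := analyticAt_clog hp
  have hdiv : ∀ b : ℂ, AnalyticAt ℂ (fun z => b / (2 * z)) p := fun b =>
    analyticAt_const.div (analyticAt_const.mul analyticAt_id) (mul_ne_zero two_ne_zero hp0)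
  have hinvN : ∀ i, AnalyticAt ℂ
      (fun z => 1 / (Complex.log z - Complex.log (-Complex.I * (y i : ℂ)))) p := fun i =>
    analyticAt_const.div (hL.sub analyticAt_const) (by rw [hneg]; exact aux_add_ne _)
  have hinvP : ∀ i, i ≠ j → AnalyticAt ℂ
      (fun z => 1 / (Complex.log z - Complex.log (Complex.I * (y i : ℂ)))) p := fun i hi =>
    analyticAt_const.div (hL.sub analyticAt_const)
      (by rw [hpos]; exact_mod_cast hd i hi)
  have hG : AnalyticAt ℂ G p := by
    refine AnalyticAt.sub (AnalyticAt.add ?_ ((hdiv _).mul (hinvN j))) ?_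
    · exact analyticAt_const.div (analyticAt_const.mul analyticAt_id)
        (mul_ne_zero (mul_ne_zero two_ne_zero Complex.I_ne_zero) hp0)
    · refine Finset.analyticAt_fun_sum _ fun i hi => ?_
      exact (hdiv _).mul ((hinvP i (Finset.ne_of_mem_erase hi)).sub (hinvN i))
  have hF : ∀ z, Fderiv12 m c₀ c y z =
      -((c j : ℂ) / (2 * z) * (1 / (Complex.log z - Complex.log p))) + G z := by
    intro z
    rw [Fderiv12, ← Finset.add_sum_erase _ _ (Finset.mem_univ j)]
    simp only [hGdef, hpdef]
    ring
  have hGp : G p = ((-c₀ / (2 * y j) - c j / (2 * Real.pi * y j) -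
      ∑ i ∈ Finset.univ.erase j, c i * Real.pi /
        (2 * y j * ((Real.log (y j) - Real.log (y i)) ^ 2 + Real.pi ^ 2)) : ℝ) : ℂ) +
      ((∑ i ∈ Finset.univ.erase j, c i * Real.pi ^ 2 /
        (2 * y j * ((Real.log (y j) - Real.log (y i)) *
          ((Real.log (y j) - Real.log (y i)) ^ 2 + Real.pi ^ 2))) : ℝ) : ℂ) * Complex.I := by
    have hs : ∑ i ∈ Finset.univ.erase j, ((c i : ℂ) / (2 * p)) *
        (1 / (Complex.log p - Complex.log (Complex.I * (y i : ℂ))) -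
        1 / (Complex.log p - Complex.log (-Complex.I * (y i : ℂ)))) =
        ∑ i ∈ Finset.univ.erase j, (((c i * Real.pi /
          (2 * y j * ((Real.log (y j) - Real.log (y i)) ^ 2 + Real.pi ^ 2)) : ℝ) : ℂ) -
          ((c i * Real.pi ^ 2 / (2 * y j * ((Real.log (y j) - Real.log (y i)) *
          ((Real.log (y j) - Real.log (y i)) ^ 2 + Real.pi ^ 2))) : ℝ) : ℂ) * Complex.I) := by
      refine Finset.sum_congr rfl fun i hi => ?_
      rw [hpos, hneg]
      exact aux_term _ _ _ hY.ne' (hd i (Finset.ne_of_mem_erase hi))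
    have hpi : (Real.pi : ℂ) ≠ 0 := by exact_mod_cast Real.pi_ne_zero
    have h0 : (c₀ : ℂ) / (2 * Complex.I * p) + (c j : ℂ) / (2 * p) *
        (1 / (Complex.log p - Complex.log (-Complex.I * (y j : ℂ)))) =
        ((-c₀ / (2 * y j) - c j / (2 * Real.pi * y j) : ℝ) : ℂ) := by
      rw [hneg, hpdef]
      have hI := Complex.I_sq
      have hI0 := Complex.I_ne_zero
      push_cast
      rw [sub_self, zero_add]
      field_simp
      rw [hI]
      ring
    simp only [hGdef]
    rw [hs, h0, Finset.sum_sub_distrib, ← Finset.sum_mul, ofReal_sub _ (Finset.sum _ _),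
      ofReal_sum, ofReal_sum]
    ring
  obtain ⟨ε₀, hε₀, hcirc⟩ := aux_integral hp (c j) G hG
  refine ⟨ε₀, hε₀, fun ε h1 h2 => ?_⟩
  simp only [hF]
  rw [hcirc ε h1 h2, hGp]
  set A : ℝ := -c₀ / (2 * y j) - c j / (2 * Real.pi * y j) -
      ∑ i ∈ Finset.univ.erase j, c i * Real.pi /
        (2 * y j * ((Real.log (y j) - Real.log (y i)) ^ 2 + Real.pi ^ 2))
  have hS : ∑ i ∈ Finset.univ.erase j, 2 * Real.pi ^ 2 * c j * c i /
                ((Real.log (y j) - Real.log (y i)) *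
                  ((Real.log (y j) - Real.log (y i)) ^ 2 + Real.pi ^ 2)) =
      4 * y j * c j * ∑ i ∈ Finset.univ.erase j, c i * Real.pi ^ 2 /
        (2 * y j * ((Real.log (y j) - Real.log (y i)) *
          ((Real.log (y j) - Real.log (y i)) ^ 2 + Real.pi ^ 2))) := by
    rw [Finset.mul_sum]
    refine Finset.sum_congr rfl fun i hi => ?_
    have := hd i (Finset.ne_of_mem_erase hi)
    have h3 : (Real.log (y j) - Real.log (y i)) ^ 2 + Real.pi ^ 2 ≠ 0 := by
      have := Real.pi_pos
      positivity
    field_simp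
    ring
  rw [hS]
  set B : ℝ := ∑ i ∈ Finset.univ.erase j, c i * Real.pi ^ 2 /
        (2 * y j * ((Real.log (y j) - Real.log (y i)) *
          ((Real.log (y j) - Real.log (y i)) ^ 2 + Real.pi ^ 2)))
  have hfin : 2 * (Real.pi : ℂ) * Complex.I * (-(c j : ℂ) ^ 2 / 4 * (1 / p + p) -
      (c j : ℂ) * (1 - p ^ 2) * ((A : ℂ) + (B : ℂ) * Complex.I)) =
      ((2 * Real.pi * ((c j) ^ 2 / 4 * (y j - 1 / y j) + c j * (1 + (y j) ^ 2) * B) : ℝ) : ℂ) +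
      ((-2 * Real.pi * c j * (1 + (y j) ^ 2) * A : ℝ) : ℂ) * Complex.I := by
    have e1 : 1 / p = -(1 / (y j : ℂ)) * Complex.I := by
      rw [hpdef, one_div, mul_inv, Complex.inv_I]; ring
    have e2 : p ^ 2 = -(y j : ℂ) ^ 2 := by rw [hpdef, mul_pow, Complex.I_sq]; ring
    rw [e1, e2, hpdef]
    push_cast
    linear_combination (2 * (Real.pi : ℂ) * (-(c j : ℂ) ^ 2 / 4 * (y j - 1 / y j) -
      c j * (1 + (y j : ℂ) ^ 2) * B)) * Complex.I_sq
  rw [hfin]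
  have hy1 : (y j) ^ 2 + 1 ≠ 0 := by positivity
  simp only [add_re, ofReal_re, mul_re, ofReal_im, I_re, I_im]
  field_simp
  ring
end
end

section
/- Let m ≥ 1, let c₀, c₁, …, c_m be real numbers, and let 0 < y₁ < y₂ < … < y_m be real numbers. Define, for z in the upper half plane minus the points I·y_i, F(z) = c₀/(2·I·z) − Σ_{i=1}^m (c_i/(2z)) · ( 1/(Complex.log z − Complex.log(I·y_i)) − 1/(Complex.log z − Complex.log(−I·y_i)) ). Then there exists ε₀ > 0 such that for all ε with 0 < ε < ε₀: −Re ∮_{C(I·y₁, ε)} F(z)² dz = (π/(2y₁)) · ( c₁² − Σ_{i=2}^m 2π²·c₁·c_i / ((Real.log y₁ − Real.log y_i)·((Real.log y₁ − Real.log y_i)² + π²)) ). -/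
noncomputable section

open Complex

/-- The derivative `ũ_z` of `ũ(z) = c₀·arg z + Σᵢ cᵢ·h_{pᵢ}(z)` with `pᵢ = I·yᵢ`. -/
def Fderiv13 (m : ℕ) (c₀ : ℝ) (c : Fin m → ℝ) (y : Fin m → ℝ) (z : ℂ) : ℂ :=
  (c₀ : ℂ) / (2 * Complex.I * z) -
    ∑ i, ((c i : ℂ) / (2 * z)) *
      (1 / (Complex.log z - Complex.log (Complex.I * (y i : ℂ))) -
        1 / (Complex.log z - Complex.log (-Complex.I * (y i : ℂ))))

lemma aux_g (p : ℂ) (hp : p ∈ Complex.slitPlane) :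
    ∃ g : ℂ → ℂ, AnalyticAt ℂ g p ∧ (∀ z, Complex.log z - Complex.log p = (z - p) * g z) ∧
      g p = p⁻¹ ∧ HasDerivAt g (-1 / (2 * p ^ 2)) p := by
  have hp0 : p ≠ 0 := Complex.slitPlane_ne_zero hp
  have hnh : Complex.slitPlane ∈ nhds p := Complex.isOpen_slitPlane.mem_nhds hp
  have hd : DifferentiableOn ℂ (dslope Complex.log p) Complex.slitPlane :=
    (Complex.differentiableOn_dslope hnh).2
      (fun z hz => (Complex.hasDerivAt_log hz).differentiableAt.differentiableWithinAt)
  have han : AnalyticAt ℂ (dslope Complex.log p) p := hd.analyticAt hnh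
  have hmul : ∀ z, Complex.log z - Complex.log p = (z - p) * dslope Complex.log p z := by
    intro z
    have := sub_smul_dslope Complex.log p z
    rw [smul_eq_mul] at this
    exact this.symm
  have hgp : dslope Complex.log p p = p⁻¹ := by
    rw [dslope_same, (Complex.hasDerivAt_log hp).deriv]
  refine ⟨dslope Complex.log p, han, hmul, hgp, ?_⟩
  set g := dslope Complex.log p with hg
  have h1 : ∀ᶠ z in nhds p, z⁻¹ = g z + (z - p) * deriv g z := by
    filter_upwards [hnh] with z hz
    have hgz : HasDerivAt g (deriv g z) z :=
      ((hd z hz).differentiableAt (Complex.isOpen_slitPlane.mem_nhds hz)).hasDerivAt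
    have e1 : HasDerivAt (fun z => (z - p) * g z) (1 * g z + (z - p) * deriv g z) z :=
      ((hasDerivAt_id z).sub_const p).mul hgz
    have e2 : HasDerivAt (fun z => (z - p) * g z) z⁻¹ z := by
      have := (Complex.hasDerivAt_log hz).sub_const (Complex.log p)
      have e : (fun z => (z - p) * g z) = fun z => Complex.log z - Complex.log p := by
        funext w; rw [hmul w]
      rw [e]; exact this
    have := e2.unique e1
    rw [this]; ring
  have hgd : HasDerivAt g (deriv g p) p := han.differentiableAt.hasDerivAt
  have hgdd : HasDerivAt (deriv g) (deriv (deriv g) p) p := han.deriv.differentiableAt.hasDerivAt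
  have e1 : HasDerivAt (fun z => g z + (z - p) * deriv g z)
      (deriv g p + (1 * deriv g p + (p - p) * deriv (deriv g) p)) p :=
    hgd.add (((hasDerivAt_id p).sub_const p).mul hgdd)
  have e2 : HasDerivAt (fun z => g z + (z - p) * deriv g z) (-(p ^ 2)⁻¹) p :=
    (hasDerivAt_inv hp0).congr_of_eventuallyEq (h1.mono fun z hz => hz.symm)
  have e3 := e2.unique e1
  have e4 : deriv g p = -1 / (2 * p ^ 2) := by
    field_simp at e3 ⊢
    linear_combination -e3
  rw [← e4]; exact hgd

lemma aux_int (p : ℂ) (hp : p ∈ Complex.slitPlane) (a : ℂ) (R : ℂ → ℂ) (hR : AnalyticAt ℂ R p) :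
    ∃ ε₀ : ℝ, 0 < ε₀ ∧ ∀ ε : ℝ, 0 < ε → ε < ε₀ →
      (∮ z in C(p, ε), (-(a / (2 * z)) * (1 / (Complex.log z - Complex.log p)) + R z) ^ 2) =
        2 * Real.pi * Complex.I * (-a * (a / (4 * p) + R p)) := by
  have hp0 : p ≠ 0 := Complex.slitPlane_ne_zero hp
  obtain ⟨g, han, hmul, hgp, hgd⟩ := aux_g p hp
  have hg0 : p * g p ≠ 0 := by rw [hgp]; simp [hp0]
  set H : ℂ → ℂ := fun z => (-(a / 2) * (z * g z)⁻¹ + (z - p) * R z) ^ 2 with hH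
  have hHan : AnalyticAt ℂ H p :=
    ((analyticAt_const.mul ((analyticAt_id.mul han).inv hg0)).add
      ((analyticAt_id.sub analyticAt_const).mul hR)).pow 2
  have hHd : HasDerivAt H (-a * (a / (4 * p) + R p)) p := by
    have h1 : HasDerivAt (fun z => z * g z) (1 * g p + p * (-1 / (2 * p ^ 2))) p :=
      (hasDerivAt_id p).mul hgd
    have h2 := (h1.fun_inv hg0).const_mul (-(a / 2))
    have h3 : HasDerivAt (fun z => (z - p) * R z) (1 * R p + (p - p) * deriv R p) p :=
      ((hasDerivAt_id p).sub_const p).mul hR.differentiableAt.hasDerivAt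
    have h4 := (h2.add h3).fun_pow 2
    refine h4.congr_deriv ?_
    simp only [Pi.add_apply]
    rw [hgp]
    field_simp
    ring
  obtain ⟨ε₀, hε₀, hball⟩ := Metric.eventually_nhds_iff_ball.1 hHan.eventually_analyticAt
  refine ⟨ε₀, hε₀, fun ε hε hlt => ?_⟩
  have hdiff : DifferentiableOn ℂ H (Metric.ball p ε₀) := fun z hz =>
    (hball z hz).differentiableAt.differentiableWithinAt
  have hC := Complex.two_pi_I_inv_smul_circleIntegral_sub_sq_inv_smul_of_differentiable
    Metric.isOpen_ball (Metric.closedBall_subset_ball hlt) hdiff (Metric.mem_ball_self hε)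
  rw [hHd.deriv] at hC
  rw [← hC, smul_eq_mul]
  have hpi : (2 * Real.pi * Complex.I : ℂ) ≠ 0 := Complex.two_pi_I_ne_zero
  rw [mul_inv_cancel_left₀ hpi]
  refine circleIntegral.integral_congr hε.le fun z hz => ?_
  have hzp : z - p ≠ 0 := by
    rw [sub_ne_zero]; rintro rfl
    simp at hz; exact hε.ne hz
  simp only [hH, smul_eq_mul]
  rw [hmul z, ← inv_pow, ← mul_pow]
  congr 1
  rw [mul_add, inv_mul_cancel_left₀ hzp]
  congr 1
  simp only [mul_inv, div_eq_mul_inv]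
  ring

lemma log_I_mul' (y : ℝ) (hy : 0 < y) :
    Complex.log (Complex.I * (y : ℂ)) = Real.log y + Real.pi / 2 * Complex.I := by
  rw [mul_comm, Complex.log_ofReal_mul hy Complex.I_ne_zero, Complex.log_I]

lemma log_neg_I_mul' (y : ℝ) (hy : 0 < y) :
    Complex.log (-Complex.I * (y : ℂ)) = Real.log y - Real.pi / 2 * Complex.I := by
  rw [mul_comm, Complex.log_ofReal_mul hy (neg_ne_zero.2 Complex.I_ne_zero), Complex.log_neg_I]
  ring

theorem force_at_lowest_point' (m : ℕ) (hm : 0 < m) (c₀ : ℝ) (c : Fin m → ℝ)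
    (y : Fin m → ℝ) (hypos : ∀ i, 0 < y i) (hmono : StrictMono y) :
    ∃ ε₀ : ℝ, 0 < ε₀ ∧ ∀ ε : ℝ, 0 < ε → ε < ε₀ →
      -(∮ z in C(Complex.I * (y ⟨0, hm⟩ : ℂ), ε), (Fderiv13 m c₀ c y z) ^ 2).re =
        Real.pi / (2 * y ⟨0, hm⟩) *
          ((c ⟨0, hm⟩) ^ 2 -
            ∑ i ∈ Finset.univ.erase (⟨0, hm⟩ : Fin m),
              2 * Real.pi ^ 2 * c ⟨0, hm⟩ * c i /
                ((Real.log (y ⟨0, hm⟩) - Real.log (y i)) *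
                  ((Real.log (y ⟨0, hm⟩) - Real.log (y i)) ^ 2 + Real.pi ^ 2))) := by
  set o : Fin m := ⟨0, hm⟩ with ho
  have hy0 := hypos o
  have hyc : (y o : ℂ) ≠ 0 := by exact_mod_cast hy0.ne'
  set p : ℂ := Complex.I * (y o : ℂ) with hp
  have hps : p ∈ Complex.slitPlane := by
    rw [Complex.mem_slitPlane_iff]; right; simp [hp, hy0.ne']
  have hp0 : p ≠ 0 := Complex.slitPlane_ne_zero hps
  have hd : ∀ i ∈ Finset.univ.erase o, Real.log (y o) - Real.log (y i) ≠ 0 := by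
    intro i hi h
    have h1 := Real.log_injOn_pos (hypos o) (hypos i) (sub_eq_zero.1 h)
    exact (Finset.ne_of_mem_erase hi) (hmono.injective h1).symm
  have hlog1 : ∀ i, Complex.log p - Complex.log (Complex.I * (y i : ℂ)) =
      ((Real.log (y o) - Real.log (y i) : ℝ) : ℂ) := by
    intro i
    rw [hp, log_I_mul' _ (hypos o), log_I_mul' _ (hypos i)]; push_cast; ring
  have hlog2 : ∀ i, Complex.log p - Complex.log (-Complex.I * (y i : ℂ)) =
      ((Real.log (y o) - Real.log (y i) : ℝ) : ℂ) + Real.pi * Complex.I := by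
    intro i
    rw [hp, log_I_mul' _ (hypos o), log_neg_I_mul' _ (hypos i)]; push_cast; ring
  have hne2 : ∀ i, Complex.log p - Complex.log (-Complex.I * (y i : ℂ)) ≠ 0 := by
    intro i h
    rw [hlog2] at h
    have := congrArg Complex.im h
    simp [Real.pi_ne_zero] at this
  have hne1 : ∀ i ∈ Finset.univ.erase o,
      Complex.log p - Complex.log (Complex.I * (y i : ℂ)) ≠ 0 := by
    intro i hi
    rw [hlog1]; exact_mod_cast hd i hi
  set R : ℂ → ℂ := fun z => (c₀ : ℂ) / (2 * Complex.I * z)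
    + ((c o : ℂ) / (2 * z)) * (1 / (Complex.log z - Complex.log (-Complex.I * (y o : ℂ))))
    - ∑ i ∈ Finset.univ.erase o, ((c i : ℂ) / (2 * z)) *
      (1 / (Complex.log z - Complex.log (Complex.I * (y i : ℂ))) -
        1 / (Complex.log z - Complex.log (-Complex.I * (y i : ℂ)))) with hRdef
  have hlogan : AnalyticAt ℂ Complex.log p := analyticAt_clog hps
  have h2p : (2 : ℂ) * p ≠ 0 := mul_ne_zero two_ne_zero hp0
  have hcz : ∀ a : ℂ, AnalyticAt ℂ (fun z : ℂ => a / (2 * z)) p := fun a =>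
    analyticAt_const.div (analyticAt_const.mul analyticAt_id) h2p
  have hone : ∀ b : ℂ, Complex.log p - b ≠ 0 →
      AnalyticAt ℂ (fun z : ℂ => 1 / (Complex.log z - b)) p := fun b hb =>
    analyticAt_const.div (hlogan.sub analyticAt_const) hb
  have hR : AnalyticAt ℂ R p := by
    refine ((analyticAt_const.div (analyticAt_const.mul analyticAt_id) ?_).add
      ((hcz _).mul (hone _ (hne2 o)))).sub ?_
    · exact mul_ne_zero (mul_ne_zero two_ne_zero Complex.I_ne_zero) hp0
    · refine Finset.analyticAt_fun_sum _ fun i hi => ?_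
      exact (hcz _).mul ((hone _ (hne1 i hi)).sub (hone _ (hne2 i)))
  have hF : ∀ z, Fderiv13 m c₀ c y z =
      -((c o : ℂ) / (2 * z)) * (1 / (Complex.log z - Complex.log p)) + R z := by
    intro z
    rw [Fderiv13, ← Finset.add_sum_erase _ _ (Finset.mem_univ o)]
    simp only [hRdef]
    ring
  obtain ⟨ε₀, hε₀, hint⟩ := aux_int p hps (c o) R hR
  refine ⟨ε₀, hε₀, fun ε hε hlt => ?_⟩
  simp only [hF]
  rw [hint ε hε hlt]
  have hRp : 2 * Real.pi * Complex.I * (-(c o : ℂ) * (c o / (4 * p) + R p)) =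
      ((-(2 * Real.pi * c o / y o) : ℝ) : ℂ) * (((c o / 4 : ℝ) : ℂ) + p * R p) := by
    have : (c o : ℂ) / (4 * p) + R p = (((c o / 4 : ℝ) : ℂ) + p * R p) / p := by
      push_cast; field_simp
    rw [this, hp]
    push_cast
    field_simp
  have hpR : p * R p = ((-(c₀ / 2) - c o / (2 * Real.pi) : ℝ) : ℂ) * Complex.I
    - ∑ i ∈ Finset.univ.erase o, ((c i / 2 : ℝ) : ℂ) *
      (1 / ((Real.log (y o) - Real.log (y i) : ℝ) : ℂ) -
        1 / (((Real.log (y o) - Real.log (y i) : ℝ) : ℂ) + Real.pi * Complex.I)) := by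
    simp only [hRdef, hlog1, hlog2]
    rw [mul_sub, Finset.mul_sum]
    congr 1
    · have hpi : (Real.pi : ℂ) ≠ 0 := by exact_mod_cast Real.pi_ne_zero
      rw [sub_self]
      push_cast
      rw [zero_add]
      field_simp
      linear_combination (Real.pi * c₀ + c o : ℂ) * Complex.I_sq
    · refine Finset.sum_congr rfl fun i _ => ?_
      push_cast
      field_simp
  have hre : (p * R p).re = - ∑ i ∈ Finset.univ.erase o, Real.pi ^ 2 * c i /
      (2 * ((Real.log (y o) - Real.log (y i)) *
        ((Real.log (y o) - Real.log (y i)) ^ 2 + Real.pi ^ 2))) := by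
    rw [hpR, Complex.sub_re, Complex.re_ofReal_mul, Complex.I_re, mul_zero, zero_sub,
      Complex.re_sum]
    congr 1
    refine Finset.sum_congr rfl fun i hi => ?_
    have hdi := hd i hi
    generalize Real.log (y o) - Real.log (y i) = d at hdi
    have hpos : d ^ 2 + Real.pi ^ 2 ≠ 0 := by positivity
    have e2 : (1 / ((d : ℂ) + Real.pi * Complex.I)).re = d / (d ^ 2 + Real.pi ^ 2) := by
      rw [one_div, Complex.inv_re, Complex.normSq_add_mul_I]; simp
    have e1 : (1 / (d : ℂ)).re = 1 / d := by
      rw [← Complex.ofReal_one, ← Complex.ofReal_div, Complex.ofReal_re]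
    rw [Complex.re_ofReal_mul, Complex.sub_re, e1, e2]
    field_simp
    ring
  rw [hRp, Complex.re_ofReal_mul, Complex.add_re, Complex.ofReal_re, hre]
  have hs : ∑ i ∈ Finset.univ.erase o, 2 * Real.pi ^ 2 * c o * c i /
      ((Real.log (y o) - Real.log (y i)) *
        ((Real.log (y o) - Real.log (y i)) ^ 2 + Real.pi ^ 2)) =
      4 * c o * ∑ i ∈ Finset.univ.erase o, Real.pi ^ 2 * c i /
      (2 * ((Real.log (y o) - Real.log (y i)) *
        ((Real.log (y o) - Real.log (y i)) ^ 2 + Real.pi ^ 2))) := by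
    rw [Finset.mul_sum]
    refine Finset.sum_congr rfl fun i hi => ?_
    have hdi := hd i hi
    generalize Real.log (y o) - Real.log (y i) = d at hdi
    have hpos : d ^ 2 + Real.pi ^ 2 ≠ 0 := by positivity
    field_simp
    ring
  rw [hs]
  field_simp
  ring
end
end
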